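/- arXiv:0904.1129 — 2 statements merged into one kernel-verified Lean document; each statement's English description precedes it below -/
import Mathlib

section
/- Let (p,q) be Schrödinger-admissible with (p,q) ≠ (∞,2) and let β > 0. Then there exist c > 0 and R₀ > 2 such that for all R ≥ R₀: ‖W_R‖_{L^p((0,R^β);L^q(ℝⁿ))} / ‖f_R‖_{L²(ℝⁿ)} ≥ c·R^{(βn − (α(n−1)+2γ))/(np)}. -/
open MeasureTheory Filter

noncomputable section

/-- Euclidean norm on `Fin m → ℝ`. -/
def euclNorm {m : ℕ} (y : Fin m → ℝ) : ℝ := Real.sqrt (∑ i, y i ^ 2)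

/-- For even `m`, the `m × m` block-diagonal matrix with `m/2` diagonal blocks
`σ = ![![0,1],![-1,0]]`. -/
def omegaMat (m : ℕ) : Matrix (Fin m) (Fin m) ℝ := fun i j =>
  if i.val % 2 = 0 ∧ j.val = i.val + 1 then 1
  else if j.val % 2 = 0 ∧ i.val = j.val + 1 then -1
  else 0

/-- The `n × n` matrix whose upper-left `k × k` block is `Ω_k` and whose remaining
entries vanish. -/
def Mmat (n k : ℕ) : Matrix (Fin n) (Fin n) ℝ := fun i j =>
  if i.val < k ∧ j.val < k then
    (if i.val % 2 = 0 ∧ j.val = i.val + 1 then 1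
     else if j.val % 2 = 0 ∧ i.val = j.val + 1 then -1
     else 0)
  else 0

/-- `i`-th partial derivative of a function on `Fin m → ℝ`. -/
def pd {m : ℕ} (f : (Fin m → ℝ) → ℂ) (i : Fin m) (y : Fin m → ℝ) : ℂ :=
  fderiv ℝ f y (Pi.single i 1)

/-- Laplacian on `Fin m → ℝ`. -/
def lapV {m : ℕ} (f : (Fin m → ℝ) → ℂ) (y : Fin m → ℝ) : ℂ :=
  ∑ i, pd (pd f i) i y

/-- Twisted Laplacian (Landau Hamiltonian)
`T v = -Δv + 2i (Ω_m y)·∇v + |y|² v` on `Fin m → ℝ`. -/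
def twistedLap (m : ℕ) (f : (Fin m → ℝ) → ℂ) (y : Fin m → ℝ) : ℂ :=
  - lapV f y + 2 * Complex.I * ∑ i, (((omegaMat m).mulVec y i : ℝ) : ℂ) * pd f i y
    + ((euclNorm y ^ 2 : ℝ) : ℂ) * f y

/-- `L^q` norm (with real exponent) of a complex-valued function. -/
def LqNorm {X : Type*} [MeasureSpace X] (q : ℝ) (f : X → ℂ) : ℝ :=
  (eLpNorm f (ENNReal.ofReal q) volume).toReal

/-- Mixed norm `‖u‖_{L^p((0,T);L^q)}`. -/
def mixedNorm {X : Type*} [MeasureSpace X] (p q T : ℝ) (u : ℝ → X → ℂ) : ℝ :=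
  (∫ t in Set.Ioo (0:ℝ) T, LqNorm q (u t) ^ p) ^ (1/p)

/-- A smooth compactly supported cutoff `ψ` with `0 ≤ ψ ≤ 1`, `ψ s = 0` for `|s| > 1`
and `ψ s = 1` for `|s| < 1/2`. -/
def IsCutoff (ψ : ℝ → ℝ) : Prop :=
  ContDiff ℝ (⊤ : ℕ∞) ψ ∧ HasCompactSupport ψ ∧ (∀ s, 0 ≤ ψ s ∧ ψ s ≤ 1) ∧
    (∀ s, 1 < |s| → ψ s = 0) ∧ (∀ s, |s| < 1/2 → ψ s = 1)

/-- `v` is a smooth nonzero eigenfunction of the twisted Laplacian on `Fin m → ℝ`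
with eigenvalue `lam`, such that `v` and `∇v` lie in every `L^p`, `1 ≤ p < ∞`. -/
def IsEigen (m : ℕ) (lam : ℝ) (v : (Fin m → ℝ) → ℂ) : Prop :=
  ContDiff ℝ (⊤ : ℕ∞) v ∧ v ≠ 0 ∧ (∀ y, twistedLap m v y = (lam : ℂ) * v y) ∧
    (∀ p : ℝ, 1 ≤ p → MemLp v (ENNReal.ofReal p) volume) ∧
    (∀ p : ℝ, 1 ≤ p → ∀ i, MemLp (pd v i) (ENNReal.ofReal p) volume)

/-- Schrödinger admissibility: `p, q ≥ 2` and `2/p = n/2 - n/q`. -/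
def SAdmissible (n : ℕ) (p q : ℝ) : Prop :=
  2 ≤ p ∧ 2 ≤ q ∧ 2 / p = (n : ℝ) / 2 - (n : ℝ) / q

/-- Rescaled eigenfunction `ω(y,z) = v(y / z^(α/2))`. -/
def omegaFn (m : ℕ) (α : ℝ) (v : (Fin m → ℝ) → ℂ) (x : (Fin m → ℝ) × ℝ) : ℂ :=
  v fun i => x.1 i / x.2 ^ (α/2)

/-- `W(t,y,z) = e^{iλt/z^α} ω(y,z)`. -/
def Wfun (m : ℕ) (α lam : ℝ) (v : (Fin m → ℝ) → ℂ) (t : ℝ)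
    (x : (Fin m → ℝ) × ℝ) : ℂ :=
  Complex.exp (Complex.I * ((lam * t / x.2 ^ α : ℝ) : ℂ)) * omegaFn m α v x

/-- `ψ_R(z) = ψ((z - R)/R^γ)`. -/
def psiR (ψ : ℝ → ℝ) (γ R z : ℝ) : ℝ := ψ ((z - R) / R ^ γ)

/-- `W_R(t,y,z) = W(t,y,z) ψ_R(z) ψ(|y|²/z²)` for `z > 0`, extended by `0` for `z ≤ 0`. -/
def WRfun (m : ℕ) (α lam : ℝ) (v : (Fin m → ℝ) → ℂ) (ψ : ℝ → ℝ) (γ R : ℝ)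
    (t : ℝ) (x : (Fin m → ℝ) × ℝ) : ℂ :=
  if 0 < x.2 then
    Wfun m α lam v t x * ((psiR ψ γ R x.2 : ℝ) : ℂ)
      * ((ψ (euclNorm x.1 ^ 2 / x.2 ^ 2) : ℝ) : ℂ)
  else 0

/-- Initial datum `f_R = W_R(0,·)`. -/
def fRfun (m : ℕ) (α lam : ℝ) (v : (Fin m → ℝ) → ℂ) (ψ : ℝ → ℝ) (γ R : ℝ) :
    (Fin m → ℝ) × ℝ → ℂ :=
  WRfun m α lam v ψ γ R 0

/-- Partial derivative in the `i`-th `y` direction on `(Fin m → ℝ) × ℝ`. -/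
def pdY {m : ℕ} (f : (Fin m → ℝ) × ℝ → ℂ) (i : Fin m)
    (x : (Fin m → ℝ) × ℝ) : ℂ :=
  fderiv ℝ f x (Pi.single i 1, 0)

/-- Partial derivative in the `z` direction on `(Fin m → ℝ) × ℝ`. -/
def pdZ {m : ℕ} (f : (Fin m → ℝ) × ℝ → ℂ) (x : (Fin m → ℝ) × ℝ) : ℂ :=
  fderiv ℝ f x (0, 1)

/-- Full spatial Laplacian on `(Fin m → ℝ) × ℝ ≃ ℝⁿ`. -/
def lapX {m : ℕ} (f : (Fin m → ℝ) × ℝ → ℂ) (x : (Fin m → ℝ) × ℝ) : ℂ :=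
  (∑ i, pdY (pdY f i) i x) + pdZ (pdZ f) x

/-- Divergence of a vector field on `(Fin m → ℝ) × ℝ`. -/
def divX {m : ℕ} (b : (Fin m → ℝ) × ℝ → (Fin m → ℝ) × ℝ)
    (x : (Fin m → ℝ) × ℝ) : ℝ :=
  (∑ i, fderiv ℝ (fun x' => (b x').1 i) x (Pi.single i 1, 0))
    + fderiv ℝ (fun x' => (b x').2) x (0, 1)

/-- `a · ∇u` for a (constant at `x`) vector `a` on `(Fin m → ℝ) × ℝ`. -/
def dotGrad {m : ℕ} (a : (Fin m → ℝ) × ℝ) (u : (Fin m → ℝ) × ℝ → ℂ)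
    (x : (Fin m → ℝ) × ℝ) : ℂ :=
  (∑ i, ((a.1 i : ℝ) : ℂ) * pdY u i x) + ((a.2 : ℝ) : ℂ) * pdZ u x

/-- Squared Euclidean length of a vector of `(Fin m → ℝ) × ℝ`. -/
def normSqPair {m : ℕ} (a : (Fin m → ℝ) × ℝ) : ℝ := euclNorm a.1 ^ 2 + a.2 ^ 2

/-- Magnetic operator `(∇ - ia)² u = Δu - 2i a·∇u - i (div a) u - |a|² u`. -/
def magSq {m : ℕ} (a : (Fin m → ℝ) × ℝ → (Fin m → ℝ) × ℝ)
    (u : (Fin m → ℝ) × ℝ → ℂ) (x : (Fin m → ℝ) × ℝ) : ℂ :=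
  lapX u x - 2 * Complex.I * dotGrad (a x) u x - Complex.I * ((divX a x : ℝ) : ℂ) * u x
    - ((normSqPair (a x) : ℝ) : ℂ) * u x

/-- The vector field `z^{-α} M(y,0)ᵗ = z^{-α} (Ω_m y, 0)`. -/
def aZ (m : ℕ) (α : ℝ) (x : (Fin m → ℝ) × ℝ) : (Fin m → ℝ) × ℝ :=
  (fun i => x.2 ^ (-α) * (omegaMat m).mulVec x.1 i, 0)

/-- `F_R = i ∂_t W_R - (∇ - i z^{-α} M(y,0)ᵗ)² W_R`. -/
def FRfun (m : ℕ) (α lam : ℝ) (v : (Fin m → ℝ) → ℂ) (ψ : ℝ → ℝ) (γ R : ℝ)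
    (t : ℝ) (x : (Fin m → ℝ) × ℝ) : ℂ :=
  Complex.I * deriv (fun s => WRfun m α lam v ψ γ R s x) t
    - magSq (aZ m α) (WRfun m α lam v ψ γ R t) x

/-- Euclidean norm of `x = (y,z) ∈ ℝ^{n-1} × ℝ`. -/
def pairNorm {m : ℕ} (x : (Fin m → ℝ) × ℝ) : ℝ :=
  Real.sqrt (euclNorm x.1 ^ 2 + x.2 ^ 2)

/-- The magnetic potential `A(x) = |x|^{-α} M x = |x|^{-α} (Ω_m y, 0)` in split
coordinates `x = (y, z)`. -/
def Asplit (m : ℕ) (α : ℝ) (x : (Fin m → ℝ) × ℝ) : (Fin m → ℝ) × ℝ :=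
  (fun i => pairNorm x ^ (-α) * (omegaMat m).mulVec x.1 i, 0)

/-- Residual `i ∂_t u - Δu + 2i A·∇u + |A|² u` of the magnetic Schrödinger equation. -/
def residOp (m : ℕ) (α : ℝ) (u : ℝ → (Fin m → ℝ) × ℝ → ℂ) (t : ℝ)
    (x : (Fin m → ℝ) × ℝ) : ℂ :=
  Complex.I * deriv (fun s => u s x) t - lapX (u t) x
    + 2 * Complex.I * dotGrad (Asplit m α x) (u t) x
    + ((normSqPair (Asplit m α x) : ℝ) : ℂ) * u t x

/-- Time-truncated residual `F̃_R = 1_{(0,R^β)}(t) (i ∂_t W_R - ΔW_R + 2i A·∇W_R + |A|² W_R)`. -/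
def FtildeR (m : ℕ) (α lam : ℝ) (v : (Fin m → ℝ) → ℂ) (ψ : ℝ → ℝ)
    (γ R β : ℝ) (t : ℝ) (x : (Fin m → ℝ) × ℝ) : ℂ :=
  if 0 < t ∧ t < R ^ β then residOp m α (WRfun m α lam v ψ γ R) t x else 0


lemma aux_norm {m : ℕ} (α lam : ℝ) (v : (Fin m → ℝ) → ℂ) (ψ : ℝ → ℝ) (γ R t : ℝ)
    (x : (Fin m → ℝ) × ℝ) :
    ‖WRfun m α lam v ψ γ R t x‖ = if 0 < x.2 then
      ‖omegaFn m α v x‖ * |psiR ψ γ R x.2| * |ψ (euclNorm x.1 ^ 2 / x.2 ^ 2)| else 0 := by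
  unfold WRfun Wfun
  split_ifs
  · rw [norm_mul, norm_mul, norm_mul, mul_comm Complex.I, Complex.norm_exp_ofReal_mul_I,
      Complex.norm_real, Complex.norm_real, one_mul, Real.norm_eq_abs, Real.norm_eq_abs]
  · simp

lemma aux_scale {m : ℕ} (g : (Fin m → ℝ) → ENNReal) (hg : Measurable g) (a : ℝ) (ha : 0 < a) :
    ∫⁻ y : Fin m → ℝ, g (fun i => y i / a) = ENNReal.ofReal (a ^ m) * ∫⁻ y, g y := by
  have h := Measure.map_addHaar_smul (volume : Measure (Fin m → ℝ)) (inv_ne_zero ha.ne')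
  have h2 : ∫⁻ y : Fin m → ℝ, g (fun i => y i / a)
      = ∫⁻ y, g y ∂(Measure.map (a⁻¹ • ·) (volume : Measure (Fin m → ℝ))) := by
    rw [lintegral_map hg (by fun_prop)]
    congr 1
    ext y
    congr 1
    ext i
    simp [div_eq_inv_mul]
  rw [h2, h, lintegral_smul_measure]
  simp [abs_of_pos ha]

lemma aux_upper {m : ℕ} (α lam : ℝ) (hα : 0 < α) (v : (Fin m → ℝ) → ℂ) (hv : Continuous v)
    (ψ : ℝ → ℝ) (hψ : IsCutoff ψ) (γ R t q : ℝ) (hq : 0 < q) (hγ : γ < 1) (hR : 1 < R) :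
    ∫⁻ x, ‖WRfun m α lam v ψ γ R t x‖ₑ ^ q ≤
      ENNReal.ofReal (2 * R ^ γ * ((2 * R) ^ (α/2)) ^ m) * ∫⁻ y, ‖v y‖ₑ ^ q := by
  have hRγ : 0 < R ^ γ := by positivity
  have hRR : R ^ γ < R := by
    conv_rhs => rw [← Real.rpow_one R]
    exact Real.rpow_lt_rpow_of_exponent_lt hR hγ
  set S : Set ℝ := Set.Icc (R - R^γ) (R + R^γ) with hS
  have hSm : MeasurableSet S := measurableSet_Icc
  have hgm : Measurable (fun y => ‖v y‖ₑ ^ q) := by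
    have := hv.measurable
    fun_prop
  have hom : Measurable (omegaFn m α v) := by
    unfold omegaFn
    have := hv.measurable
    apply this.comp
    fun_prop
  have hmeas : Measurable (fun x : (Fin m → ℝ) × ℝ =>
      S.indicator (fun _ => (1:ENNReal)) x.2 * ‖omegaFn m α v x‖ₑ ^ q) := by
    apply Measurable.mul
    · exact (measurable_const.indicator hSm).comp measurable_snd
    · fun_prop
  calc ∫⁻ x, ‖WRfun m α lam v ψ γ R t x‖ₑ ^ q
      ≤ ∫⁻ x : (Fin m → ℝ) × ℝ, S.indicator (fun _ => (1:ENNReal)) x.2 * ‖omegaFn m α v x‖ₑ ^ q := by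
        apply lintegral_mono
        intro x
        simp only
        by_cases hx : x.2 ∈ S
        · simp only [Set.indicator_of_mem hx, one_mul]
          gcongr
          rw [enorm_le_iff_norm_le, aux_norm]
          split_ifs
          · have h1 := hψ.2.2.1 ((x.2 - R) / R ^ γ)
            have h2 := hψ.2.2.1 (euclNorm x.1 ^ 2 / x.2 ^ 2)
            unfold psiR
            rw [abs_of_nonneg h1.1, abs_of_nonneg h2.1]
            have h0 := norm_nonneg (omegaFn m α v x)
            calc _ ≤ ‖omegaFn m α v x‖ * 1 * 1 := by
                  gcongr
                  · exact h2.1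
                  · exact h1.2
                  · exact h2.2
              _ = _ := by ring
          · positivity
        · have : WRfun m α lam v ψ γ R t x = 0 := by
            rw [← norm_eq_zero, aux_norm]
            have : psiR ψ γ R x.2 = 0 := by
              apply hψ.2.2.2.1
              rw [abs_div, abs_of_pos hRγ, lt_div_iff₀ hRγ, one_mul]
              by_contra hc
              rw [not_lt, abs_le] at hc
              exact hx ⟨by linarith, by linarith⟩
            simp [this]
          simp [this, hq]
    _ = ∫⁻ z, ∫⁻ y, S.indicator (fun _ => (1:ENNReal)) z * ‖omegaFn m α v (y, z)‖ₑ ^ q :=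
        lintegral_prod_symm' _ hmeas
    _ ≤ ∫⁻ z, S.indicator (fun _ => ENNReal.ofReal (((2 * R) ^ (α/2)) ^ m)
          * ∫⁻ y, ‖v y‖ₑ ^ q) z := by
        apply lintegral_mono
        intro z
        by_cases hz : z ∈ S
        · simp only [Set.indicator_of_mem hz, one_mul]
          have hz0 : 0 < z := by have := hz.1; linarith
          have hz2 : z ≤ 2 * R := by have := hz.2; linarith
          unfold omegaFn
          simp only
          rw [aux_scale (fun y => ‖v y‖ₑ ^ q) hgm _ (by positivity)]
          gcongr
        · simp [Set.indicator_of_notMem hz]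
    _ = _ := by
        rw [lintegral_indicator hSm, setLIntegral_const, hS, Real.volume_Icc, mul_comm, ← mul_assoc,
          ← ENNReal.ofReal_mul (by linarith)]
        congr 3
        ring

lemma aux_lower {m : ℕ} (α lam : ℝ) (hα : 0 < α) (hα2 : α < 2) (v : (Fin m → ℝ) → ℂ)
    (hv : Continuous v) (hv0 : v ≠ 0)
    (ψ : ℝ → ℝ) (hψ : IsCutoff ψ) (γ q : ℝ) (hq : 0 < q) :
    ∃ c R₀ : ℝ, 0 < c ∧ 2 < R₀ ∧ ∀ R, R₀ ≤ R → ∀ t,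
    ENNReal.ofReal (c * (R ^ γ * (R ^ (α/2)) ^ m)) ≤
      ∫⁻ x, ‖WRfun m α lam v ψ γ R t x‖ₑ ^ q := by
  obtain ⟨y0, hy0⟩ := Function.ne_iff.1 hv0
  have hy0' : 0 < ‖v y0‖ := norm_pos_iff.2 hy0
  set δ := ‖v y0‖ / 2 with hδ
  have hδ0 : 0 < δ := by positivity
  set K := (∑ i, y0 i ^ 2) + 1 with hK
  have hK0 : 0 < K := by positivity
  set B : Set (Fin m → ℝ) := {y | δ < ‖v y‖ ∧ ∑ i, y i ^ 2 < K} with hB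
  have hBo : IsOpen B := by
    have h1 : IsOpen {y : Fin m → ℝ | δ < ‖v y‖} := isOpen_lt continuous_const hv.norm
    have h2 : IsOpen {y : Fin m → ℝ | ∑ i, y i ^ 2 < K} :=
      isOpen_lt (by fun_prop) continuous_const
    exact h1.inter h2
  have hBm := hBo.measurableSet
  have hBpos : 0 < volume B := hBo.measure_pos volume ⟨y0, by rw [hδ]; linarith, by rw [hK]; linarith⟩
  obtain ⟨b, hb0, hb⟩ : ∃ b : ℝ, 0 < b ∧ ENNReal.ofReal b ≤ volume B := by
    have h1 : min (volume B) 1 ≠ ⊤ := by simp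
    refine ⟨(min (volume B) 1).toReal, ENNReal.toReal_pos (by simp [hBpos.ne']) h1, ?_⟩
    rw [ENNReal.ofReal_toReal h1]
    exact min_le_left _ _
  have hlim : Tendsto (fun R : ℝ => R ^ (-(2 - α)) * K) atTop (nhds (0 * K)) :=
    (tendsto_rpow_neg_atTop (by linarith)).mul_const K
  rw [zero_mul] at hlim
  obtain ⟨R1, hR1⟩ := eventually_atTop.1 (hlim.eventually (gt_mem_nhds (show (0:ℝ) < 1/2 by norm_num)))
  refine ⟨δ ^ q * b / 2, max R1 3, by positivity, lt_of_lt_of_le (by norm_num) (le_max_right _ _), ?_⟩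
  intro R hR t
  have hR3 : 3 ≤ R := le_trans (le_max_right _ _) hR
  have hR0 : 0 < R := by linarith
  have hRγ : 0 < R ^ γ := by positivity
  have hsm := hR1 R (le_trans (le_max_left _ _) hR)
  set S : Set ℝ := Set.Ico R (R + R^γ/2) with hS
  have hSm : MeasurableSet S := measurableSet_Ico
  have hmeas : Measurable (fun x : (Fin m → ℝ) × ℝ => S.indicator (fun _ => (1:ENNReal)) x.2 *
      B.indicator (fun _ => ENNReal.ofReal (δ ^ q)) (fun i => x.1 i / x.2 ^ (α/2))) := by
    apply Measurable.mul
    · exact (measurable_const.indicator hSm).comp measurable_snd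
    · apply (measurable_const.indicator hBm).comp
      fun_prop
  calc ENNReal.ofReal (δ ^ q * b / 2 * (R ^ γ * (R ^ (α/2)) ^ m))
      = ENNReal.ofReal ((R ^ (α/2)) ^ m) * (ENNReal.ofReal (δ ^ q) * ENNReal.ofReal b) *
        ENNReal.ofReal (R^γ/2) := by
        rw [← ENNReal.ofReal_mul (by positivity), ← ENNReal.ofReal_mul (by positivity),
          ← ENNReal.ofReal_mul (by positivity)]
        congr 1
        ring
    _ ≤ ENNReal.ofReal ((R ^ (α/2)) ^ m) * (ENNReal.ofReal (δ ^ q) * volume B) * volume S := by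
        rw [hS, Real.volume_Ico, add_sub_cancel_left]
        gcongr
    _ = ∫⁻ z, S.indicator (fun _ => ENNReal.ofReal ((R ^ (α/2)) ^ m)
          * (ENNReal.ofReal (δ ^ q) * volume B)) z := by
        rw [lintegral_indicator hSm, setLIntegral_const]
    _ ≤ ∫⁻ z, ∫⁻ y : Fin m → ℝ, S.indicator (fun _ => (1:ENNReal)) z *
      B.indicator (fun _ => ENNReal.ofReal (δ ^ q)) (fun i => y i / z ^ (α/2)) := by
        apply lintegral_mono
        intro z
        by_cases hz : z ∈ S
        · simp only [Set.indicator_of_mem hz, one_mul]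
          have hz0 : 0 < z := by have := hz.1; linarith
          rw [aux_scale (B.indicator (fun _ => ENNReal.ofReal (δ ^ q)))
            (measurable_const.indicator hBm) _ (by positivity), lintegral_indicator hBm,
            setLIntegral_const]
          have := hz.1
          gcongr
        · simp [Set.indicator_of_notMem hz]
    _ = ∫⁻ x : (Fin m → ℝ) × ℝ, S.indicator (fun _ => (1:ENNReal)) x.2 *
      B.indicator (fun _ => ENNReal.ofReal (δ ^ q)) (fun i => x.1 i / x.2 ^ (α/2)) :=
        (lintegral_prod_symm' _ hmeas).symm
    _ ≤ _ := by
        apply lintegral_mono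
        intro x
        simp only
        by_cases hx : x.2 ∈ S
        swap
        · simp [Set.indicator_of_notMem hx]
        by_cases hx' : (fun i => x.1 i / x.2 ^ (α/2)) ∈ B
        swap
        · simp [Set.indicator_of_notMem hx']
        rw [Set.indicator_of_mem hx, Set.indicator_of_mem hx', one_mul,
          ← ENNReal.ofReal_rpow_of_pos hδ0]
        gcongr
        rw [← ofReal_norm]
        apply ENNReal.ofReal_le_ofReal
        have hz := hx.1
        have hz0 : 0 < x.2 := by linarith
        have hz2 := hx.2
        rw [aux_norm, if_pos hz0]
        have h1 : psiR ψ γ R x.2 = 1 := by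
          apply hψ.2.2.2.2
          rw [abs_div, abs_of_pos hRγ, div_lt_iff₀ hRγ, abs_of_nonneg (by linarith)]
          linarith
        have h2 : ψ (euclNorm x.1 ^ 2 / x.2 ^ 2) = 1 := by
          apply hψ.2.2.2.2
          rw [abs_of_nonneg (by positivity)]
          have h3 := hx'.2
          simp only [div_pow] at h3
          rw [← Finset.sum_div] at h3
          have h4 : (x.2 ^ (α/2)) ^ 2 = x.2 ^ α := by
            rw [← Real.rpow_natCast, ← Real.rpow_mul hz0.le]
            congr 1
            push_cast
            ring
          rw [h4, div_lt_iff₀ (by positivity)] at h3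
          unfold euclNorm
          rw [Real.sq_sqrt (by positivity)]
          have h5 : x.2 ^ (-(2 - α)) ≤ R ^ (-(2 - α)) :=
            Real.rpow_le_rpow_of_nonpos hR0 hz (by linarith)
          have h6 : x.2 ^ (-(2 - α)) * x.2 ^ 2 = x.2 ^ α := by
            rw [← Real.rpow_natCast, ← Real.rpow_add hz0]
            congr 1
            push_cast
            ring
          rw [div_lt_iff₀ (by positivity)]
          calc _ < K * x.2 ^ α := h3
            _ = x.2 ^ (-(2 - α)) * K * x.2 ^ 2 := by rw [← h6]; ring
            _ ≤ R ^ (-(2 - α)) * K * x.2 ^ 2 := by gcongr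
            _ ≤ _ := by gcongr
        rw [h1, h2]
        simpa [omegaFn] using hx'.1.le

lemma aux_eLp {X : Type*} [MeasureSpace X] (f : X → ℂ) (q : ℝ) (hq : 0 < q) :
    (eLpNorm f (ENNReal.ofReal q) volume).toReal = (∫⁻ x, ‖f x‖ₑ ^ q).toReal ^ (1/q) := by
  rw [eLpNorm_eq_lintegral_rpow_enorm_toReal (by simpa using hq) (by simp),
    ENNReal.toReal_ofReal hq.le, ENNReal.toReal_rpow]

/-- `‖W_R‖_{L^p((0,R^β);L^q)} / ‖f_R‖_{L²} ≥ c R^{(βn - (α(n-1)+2γ))/(np)}`. -/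
theorem WR_fR_ratio_odd (n : ℕ) (hn : 3 ≤ n) (hodd : Odd n)
    (α : ℝ) (hα1 : 1 < α) (hα2 : α < 2)
    (lam : ℝ) (v : (Fin (n-1) → ℝ) → ℂ) (hv : IsEigen (n-1) lam v)
    (ψ : ℝ → ℝ) (hψ : IsCutoff ψ) (γ : ℝ) (hγ1 : 1/2 < γ) (hγ2 : γ < 1)
    (p q : ℝ) (hpq : SAdmissible n p q) (β : ℝ) (hβ : 0 < β) :
    ∃ c R₀ : ℝ, 0 < c ∧ 2 < R₀ ∧ ∀ R : ℝ, R₀ ≤ R →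
      c * R ^ ((β * (n:ℝ) - (α * ((n:ℝ) - 1) + 2*γ)) / ((n:ℝ) * p)) ≤
        mixedNorm p q (R ^ β) (WRfun (n-1) α lam v ψ γ R)
          / (eLpNorm (fRfun (n-1) α lam v ψ γ R) 2 volume).toReal := by
  obtain ⟨hp, hq, hadm⟩ := hpq
  obtain ⟨hvs, hv0, -, hvL, -⟩ := hv
  have hvc : Continuous v := hvs.continuous
  have hp0 : 0 < p := by linarith
  have hq0 : 0 < q := by linarith
  have hα : 0 < α := by linarith
  have hfin : ∀ r : ℝ, 1 ≤ r → ∫⁻ y, ‖v y‖ₑ ^ r ≠ ⊤ := by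
    intro r hr
    have h := lintegral_rpow_enorm_lt_top_of_eLpNorm_lt_top (f := v) (μ := volume)
      (p := ENNReal.ofReal r) (by simp; linarith) (by simp) (hvL r hr).2
    rw [ENNReal.toReal_ofReal (by linarith)] at h
    exact h.ne
  obtain ⟨c1, R1, hc1, hR1, hL1⟩ := aux_lower α lam hα hα2 v hvc hv0 ψ hψ γ q hq0
  obtain ⟨c2, R2, hc2, hR2, hL2⟩ := aux_lower α lam hα hα2 v hvc hv0 ψ hψ γ 2 (by norm_num)
  set J := (∫⁻ y, ‖v y‖ₑ ^ (2:ℝ)).toReal with hJ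
  have hJ0 : 0 ≤ J := ENNReal.toReal_nonneg
  set C := 2 * ((2:ℝ) ^ (α/2)) ^ (n-1) * (J + 1) with hC
  have hC0 : 0 < C := by positivity
  refine ⟨c1 ^ (1/q) / C ^ ((1:ℝ)/2), max R1 R2, by positivity, by simp [hR1], ?_⟩
  intro R hR
  have hRR1 : R1 ≤ R := le_trans (le_max_left _ _) hR
  have hRR2 : R2 ≤ R := le_trans (le_max_right _ _) hR
  have hR0 : 0 < R := by linarith
  set D := R ^ γ * (R ^ (α/2)) ^ (n-1) with hD
  have hD0 : 0 < D := by positivity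
  have hDR : D = R ^ (γ + α / 2 * ((n:ℝ) - 1)) := by
    rw [hD, ← Real.rpow_natCast, ← Real.rpow_mul hR0.le, ← Real.rpow_add hR0,
      Nat.cast_sub (by omega)]
    simp
  set f := fRfun (n-1) α lam v ψ γ R with hf
  have hfW : ∀ t, ∀ x, ‖WRfun (n-1) α lam v ψ γ R t x‖ = ‖f x‖ := by
    intro t x
    rw [hf, fRfun, aux_norm, aux_norm]
  have hUfin : ∀ r : ℝ, 1 ≤ r → ∫⁻ x, ‖f x‖ₑ ^ r ≠ ⊤ := by
    intro r hr
    refine ne_top_of_le_ne_top ?_ (aux_upper α lam hα v hvc ψ hψ γ R 0 r (by linarith) hγ2 (by linarith))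
    exact ENNReal.mul_ne_top (by simp) (hfin r hr)
  set Nq := (eLpNorm f (ENNReal.ofReal q) volume).toReal with hNq
  have hNq0 : 0 ≤ Nq := ENNReal.toReal_nonneg
  have hmix : mixedNorm p q (R ^ β) (WRfun (n-1) α lam v ψ γ R) = R ^ (β / p) * Nq := by
    unfold mixedNorm
    have h1 : ∀ t, LqNorm q (WRfun (n-1) α lam v ψ γ R t) = Nq := by
      intro t
      unfold LqNorm
      rw [hNq]
      congr 1
      exact eLpNorm_congr_norm_ae (Eventually.of_forall (hfW t))
    simp only [h1]
    rw [setIntegral_const, Measure.real, Real.volume_Ioo, sub_zero,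
      ENNReal.toReal_ofReal (by positivity), smul_eq_mul,
      Real.mul_rpow (by positivity) (by positivity), ← Real.rpow_mul hR0.le, ← Real.rpow_mul hNq0]
    rw [mul_one_div, mul_one_div_cancel hp0.ne', Real.rpow_one]
  have hNqlow : (c1 * D) ^ (1/q) ≤ Nq := by
    rw [hNq, aux_eLp f q hq0]
    apply Real.rpow_le_rpow (by positivity) _ (by positivity)
    exact (ENNReal.ofReal_le_iff_le_toReal (hUfin q (by linarith))).1 (hL1 R hRR1 0)
  have hN2 : (eLpNorm f 2 volume).toReal = (∫⁻ x, ‖f x‖ₑ ^ (2:ℝ)).toReal ^ ((1:ℝ)/2) := by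
    rw [← aux_eLp f 2 (by norm_num)]
    norm_num
  have hN2pos : 0 < (eLpNorm f 2 volume).toReal := by
    rw [hN2]
    apply Real.rpow_pos_of_pos
    refine lt_of_lt_of_le ?_ ((ENNReal.ofReal_le_iff_le_toReal (hUfin 2 (by norm_num))).1 (hL2 R hRR2 0))
    positivity
  have hN2up : (eLpNorm f 2 volume).toReal ≤ (C * D) ^ ((1:ℝ)/2) := by
    rw [hN2]
    apply Real.rpow_le_rpow ENNReal.toReal_nonneg _ (by norm_num)
    have h := aux_upper α lam hα v hvc ψ hψ γ R 0 2 (by norm_num) hγ2 (by linarith)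
    have h' := ENNReal.toReal_mono (ENNReal.mul_ne_top (by simp) (hfin 2 (by norm_num))) h
    rw [ENNReal.toReal_mul, ENNReal.toReal_ofReal (by positivity)] at h'
    refine h'.trans ?_
    rw [← hJ, Real.mul_rpow (by norm_num) hR0.le, mul_pow]
    calc _ = 2 * ((2:ℝ) ^ (α/2)) ^ (n-1) * J * D := by rw [hD]; ring
      _ ≤ _ := by
        rw [hC]
        gcongr
        linarith
  rw [hmix, le_div_iff₀ hN2pos]
  have hn0 : (0:ℝ) < n := by positivity
  have hexp : (β * (n:ℝ) - (α * ((n:ℝ) - 1) + 2*γ)) / ((n:ℝ) * p) =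
      β / p + (γ + α / 2 * ((n:ℝ) - 1)) * (1/q - 1/2) := by
    have h1 : 1/q - 1/2 = - (2 / p) / n := by
      rw [hadm]
      field_simp
      ring
    rw [h1]
    field_simp
    ring
  calc _ ≤ c1 ^ (1/q) / C ^ ((1:ℝ)/2) * R ^ ((β * (n:ℝ) - (α * ((n:ℝ) - 1) + 2*γ)) / ((n:ℝ) * p))
        * (C * D) ^ ((1:ℝ)/2) := by gcongr
    _ = R ^ (β / p) * (c1 * D) ^ (1/q) := by
        rw [hexp, Real.rpow_add hR0, Real.rpow_mul hR0.le, ← hDR, Real.rpow_sub hD0,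
          Real.mul_rpow hC0.le hD0.le, Real.mul_rpow hc1.le hD0.le]
        have : 0 < C ^ ((1:ℝ)/2) := by positivity
        have : 0 < D ^ ((1:ℝ)/2) := by positivity
        field_simp
    _ ≤ _ := by gcongr
end
end

section
/- For all t ∈ ℝ, y ∈ ℝ^{n−1} and z > 0, the function W satisfies the identity i∂_t W − (∇ − i z^{−α} M(y,0)ᵗ)² W = F(t,y,z), where F(t,y,z) = (e^{iλt/z^α}/z²)·{ [α²λ²t²/z^{2α} − α(α+1)iλt/z^α]·v(y/z^{α/2}) − [α²iλt/z^α + α(α+2)/4]·G(y/z^{α/2}) − (α²/4)·H(y/z^{α/2}) }, with G(w) := w·∇v(w) and H(w) := wᵗ·D²v(w)·w (D²v the Hessian of v). -/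
open MeasureTheory Filter

noncomputable section

/-- `G(w) = w · ∇v(w)`. -/
def Gv (m : ℕ) (v : (Fin m → ℝ) → ℂ) (w : Fin m → ℝ) : ℂ :=
  ∑ i, ((w i : ℝ) : ℂ) * pd v i w

/-- `H(w) = wᵗ · D²v(w) · w`. -/
def Hv (m : ℕ) (v : (Fin m → ℝ) → ℂ) (w : Fin m → ℝ) : ℂ :=
  ∑ i, ∑ j, ((w i : ℝ) : ℂ) * ((w j : ℝ) : ℂ) * pd (pd v j) i w

theorem fderiv_eq_sum_pd {m : ℕ} (u : (Fin m → ℝ) → ℂ) (w h : Fin m → ℝ) :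
    fderiv ℝ u w h = ∑ i, ((h i : ℝ) : ℂ) * pd u i w := by
  have := LinearMap.pi_apply_eq_sum_univ (fderiv ℝ u w : (Fin m → ℝ) →ₗ[ℝ] ℂ) h
  simp only [ContinuousLinearMap.coe_coe] at this
  rw [this]
  refine Finset.sum_congr rfl fun i _ => ?_
  rw [Complex.real_smul]
  congr 2
  ext j
  simp [Pi.single_apply, eq_comm]

theorem core {m : ℕ} (α : ℝ) (u : (Fin m → ℝ) → ℂ) (hu : Differentiable ℝ u)
    (φ : ℝ → ℂ) (φ' : ℂ) (y : Fin m → ℝ) (z : ℝ) (hz : 0 < z) (hφ : HasDerivAt φ φ' z) :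
    let f : (Fin m → ℝ) × ℝ → ℂ := fun x => φ x.2 * u (fun i => x.1 i / x.2 ^ (α/2))
    DifferentiableAt ℝ f (y, z) ∧
    (∀ i, pdY f i (y, z) =
      (φ z * ((z ^ (-(α/2)) : ℝ) : ℂ)) * pd u i (fun i => y i / z ^ (α/2))) ∧
    pdZ f (y, z) = φ' * u (fun i => y i / z ^ (α/2)) +
      (-((α/2 : ℝ) : ℂ) * φ z / (z : ℂ)) * Gv m u (fun i => y i / z ^ (α/2)) := by
  intro f
  have hzz : z ^ (α/2) ≠ 0 := (Real.rpow_pos_of_pos hz _).ne'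
  have h2 : HasFDerivAt (fun x : (Fin m → ℝ) × ℝ => x.2)
      (ContinuousLinearMap.snd ℝ (Fin m → ℝ) ℝ) (y, z) := hasFDerivAt_snd
  have hφ2 := (hφ.hasFDerivAt.comp (y, z) h2)
  have hr : HasDerivAt (fun s : ℝ => s ^ (-(α/2))) (-(α/2) * z ^ (-(α/2) - 1)) z :=
    Real.hasDerivAt_rpow_const (Or.inl hz.ne')
  have hr2 := (hr.hasFDerivAt.comp (y, z) h2)
  have hw : HasFDerivAt (fun x : (Fin m → ℝ) × ℝ => fun i => x.1 i * x.2 ^ (-(α/2)))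
      (ContinuousLinearMap.pi fun i => y i • ((ContinuousLinearMap.toSpanSingleton ℝ (-(α/2) * z ^ (-(α/2) - 1))).comp (ContinuousLinearMap.snd ℝ (Fin m → ℝ) ℝ)) + (z ^ (-(α/2))) • ((ContinuousLinearMap.proj i).comp (ContinuousLinearMap.fst ℝ (Fin m → ℝ) ℝ))) (y, z) := by
    rw [hasFDerivAt_pi]
    intro i
    have h1 : HasFDerivAt (fun x : (Fin m → ℝ) × ℝ => x.1 i)
      ((ContinuousLinearMap.proj i).comp (ContinuousLinearMap.fst ℝ (Fin m → ℝ) ℝ)) (y, z) :=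
      ((ContinuousLinearMap.proj (R := ℝ) (φ := fun _ : Fin m => ℝ) i).comp (ContinuousLinearMap.fst ℝ (Fin m → ℝ) ℝ)).hasFDerivAt
    exact h1.mul hr2
  have heq : ∀ (y : Fin m → ℝ) (z : ℝ), 0 < z →
      (fun i => y i / z ^ (α/2)) = fun i => y i * z ^ (-(α/2)) := by
    intro y z hz
    ext i
    rw [Real.rpow_neg hz.le]; rfl
  have hu2 := ((hu (fun i => y i * z ^ (-(α/2)))).hasFDerivAt.comp (y, z) hw)
  have hf := hφ2.mul hu2
  have hev : f =ᶠ[nhds (y, z)] (φ ∘ fun x : (Fin m → ℝ) × ℝ => x.2) *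
      (u ∘ fun x => fun i => x.1 i * x.2 ^ (-(α/2))) := by
    have : ∀ᶠ x : (Fin m → ℝ) × ℝ in nhds (y, z), 0 < x.2 :=
      (continuous_snd.tendsto (y, z)).eventually (lt_mem_nhds hz)
    filter_upwards [this] with x hx
    simp only [f, Pi.mul_apply, Function.comp]
    rw [heq _ _ hx]
  have hf' := hf.congr_of_eventuallyEq hev
  refine ⟨hf'.differentiableAt, ?_, ?_⟩
  · intro i
    rw [pdY, hf'.fderiv, heq y z hz]
    simp only [add_apply, smul_apply,
      ContinuousLinearMap.comp_apply, fderiv_eq_sum_pd]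
    simp [Pi.single_apply, mul_assoc, apply_ite Complex.ofReal]
  · rw [pdZ, hf'.fderiv, heq y z hz]
    simp only [add_apply, smul_apply,
      ContinuousLinearMap.comp_apply, fderiv_eq_sum_pd, Gv]
    have hp : z ^ (-(α/2) - 1) = z ^ (-(α/2)) / z := Real.rpow_sub_one hz.ne' _
    simp [hp, Finset.mul_sum]
    rw [add_comm]
    congr 1
    · ring
    · rw [← Finset.sum_neg_distrib]
      refine Finset.sum_congr rfl fun i _ => ?_
      ring

theorem Gv_Gv {m : ℕ} (v : (Fin m → ℝ) → ℂ) (hv : ∀ i, Differentiable ℝ (pd v i))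
    (w : Fin m → ℝ) : Gv m (Gv m v) w = Gv m v w + Hv m v w := by
  have h : ∀ i, pd (Gv m v) i w = pd v i w + ∑ j, ((w j : ℝ) : ℂ) * pd (pd v j) i w := by
    intro i
    have hj : ∀ j ∈ (Finset.univ : Finset (Fin m)), HasFDerivAt (fun w : Fin m → ℝ => ((w j : ℝ) : ℂ) * pd v j w)
        _ w := fun j _ =>
      ((Complex.ofRealCLM.comp (ContinuousLinearMap.proj (R := ℝ) (φ := fun _ : Fin m => ℝ) j)).hasFDerivAt (x := w)).mul (hv j w).hasFDerivAt
    have := HasFDerivAt.fun_sum hj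
    have h2 : pd (Gv m v) i w = _ := congrArg (fun L => L (Pi.single i 1)) this.fderiv
    rw [h2]
    simp [Finset.sum_add_distrib, Pi.single_apply, pd, apply_ite Complex.ofReal]
    rw [add_comm]
  simp only [Gv, Hv] at h ⊢
  simp only [h, mul_add, Finset.sum_add_distrib, Finset.mul_sum, mul_assoc]

theorem differentiable_pd {m : ℕ} (v : (Fin m → ℝ) → ℂ) (hv : ContDiff ℝ 2 v) (i : Fin m) :
    Differentiable ℝ (pd v i) := by
  have h : ContDiff ℝ 1 (fderiv ℝ v) := hv.fderiv_right (by norm_num)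
  exact (h.differentiable (by norm_num)).clm_apply (differentiable_const _)

theorem differentiable_Gv {m : ℕ} (v : (Fin m → ℝ) → ℂ) (hv : ContDiff ℝ 2 v) :
    Differentiable ℝ (Gv m v) := by
  have := differentiable_pd v hv
  unfold Gv
  refine Differentiable.fun_sum fun i _ => Differentiable.mul ?_ (this i)
  exact (Complex.ofRealCLM.comp (ContinuousLinearMap.proj (R := ℝ) (φ := fun _ : Fin m => ℝ) i)).differentiable

def tau {m : ℕ} (hm : Even m) (i : Fin m) : Fin m :=
  if h : i.val % 2 = 0 then ⟨i.val + 1, by have := i.2; obtain ⟨k, hk⟩ := hm; omega⟩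
  else ⟨i.val - 1, by have := i.2; omega⟩

theorem tau_tau {m : ℕ} (hm : Even m) (i : Fin m) : tau hm (tau hm i) = i := by
  have := i.2
  by_cases h : i.val % 2 = 0
  · have h' : ¬ (i.val + 1) % 2 = 0 := by omega
    simp [tau, h, h']
  · have h' : (i.val - 1) % 2 = 0 := by omega
    simp only [tau, h, h', dite_true, dite_false]
    ext; simp; omega

theorem omega_sq {m : ℕ} (hm : Even m) (y : Fin m → ℝ) (i : Fin m) :
    ((omegaMat m).mulVec y i) ^ 2 = y (tau hm i) ^ 2 := by
  by_cases h : i.val % 2 = 0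
  · have : (omegaMat m).mulVec y i = y (tau hm i) := by
      rw [Matrix.mulVec, dotProduct, Finset.sum_eq_single (tau hm i)]
      · simp [omegaMat, tau, h]
      · intro j _ hj
        have : ¬ j.val = i.val + 1 := by
          intro h2; apply hj; ext; simp [tau, h, h2]
        have h3 : ¬ (j.val % 2 = 0 ∧ i.val = j.val + 1) := by omega
        simp [omegaMat, h, this, h3]
      · simp
    rw [this]
  · have : (omegaMat m).mulVec y i = - y (tau hm i) := by
      rw [Matrix.mulVec, dotProduct, Finset.sum_eq_single (tau hm i)]
      · have h3 : (i.val - 1) % 2 = 0 ∧ i.val = i.val - 1 + 1 := by omega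
        simp only [omegaMat, tau, h, dite_false, false_and, if_false]
        rw [if_pos h3]; ring
      · intro j _ hj
        have h3 : ¬ (j.val % 2 = 0 ∧ i.val = j.val + 1) := by
          intro h2; apply hj; ext; simp [tau, h]; omega
        simp [omegaMat, h, h3]
      · simp
    rw [this]; ring

theorem sum_omega_sq {m : ℕ} (hm : Even m) (y : Fin m → ℝ) :
    ∑ i, ((omegaMat m).mulVec y i) ^ 2 = ∑ i, y i ^ 2 := by
  simp only [omega_sq hm]
  exact Equiv.sum_comp (⟨tau hm, tau hm, tau_tau hm, tau_tau hm⟩ : Fin m ≃ Fin m) (fun i => y i ^ 2)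

theorem euclNorm_sq {m : ℕ} (y : Fin m → ℝ) : euclNorm y ^ 2 = ∑ i, y i ^ 2 :=
  Real.sq_sqrt (Finset.sum_nonneg fun _ _ => sq_nonneg _)

theorem divX_aZ (m : ℕ) (α : ℝ) (y : Fin m → ℝ) (z : ℝ) (hz : 0 < z) :
    divX (aZ m α) (y, z) = 0 := by
  have h : ∀ i, fderiv ℝ (fun x' => (aZ m α x').1 i) (y, z) (Pi.single i 1, 0) = 0 := by
    intro i
    have h2 : HasFDerivAt (fun x : (Fin m → ℝ) × ℝ => x.2)
        (ContinuousLinearMap.snd ℝ (Fin m → ℝ) ℝ) (y, z) := hasFDerivAt_snd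
    have hr : HasDerivAt (fun s : ℝ => s ^ (-α)) (-α * z ^ (-α - 1)) z :=
      Real.hasDerivAt_rpow_const (Or.inl hz.ne')
    have hr2 := (hr.hasFDerivAt.comp (y, z) h2)
    let L : ((Fin m → ℝ) × ℝ) →L[ℝ] ℝ := (LinearMap.toContinuousLinearMap
      ((LinearMap.proj i).comp (omegaMat m).mulVecLin)).comp (ContinuousLinearMap.fst ℝ (Fin m → ℝ) ℝ)
    have h1 : HasFDerivAt (fun x : (Fin m → ℝ) × ℝ => (omegaMat m).mulVec x.1 i) L (y, z) :=
      L.hasFDerivAt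
    have h3 := hr2.mul h1
    have h4 : fderiv ℝ (fun x' => (aZ m α x').1 i) (y, z) = _ := h3.fderiv
    rw [h4]
    have h5 : ¬ (i.val % 2 = 0 ∧ i.val = i.val + 1) := by omega
    have h6 : L (Pi.single i 1, 0) = 0 := by
      simp [L, omegaMat]
    simp [h6]
  simp only [divX, h]
  simp [aZ]


theorem hasDerivAt_q (α z : ℝ) (hz : 0 < z) :
    HasDerivAt (fun s : ℝ => ((s ^ (-α) : ℝ) : ℂ)) (-(α : ℂ) * ((z ^ (-α) : ℝ) : ℂ) / (z : ℂ)) z := by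
  have hr : HasDerivAt (fun s : ℝ => s ^ (-α)) (-α * z ^ (-α - 1)) z :=
    Real.hasDerivAt_rpow_const (Or.inl hz.ne')
  have := hr.ofReal_comp
  refine this.congr_deriv ?_
  rw [Real.rpow_sub_one hz.ne']
  push_cast
  ring

theorem hasDerivAt_E (α c z : ℝ) (hz : 0 < z) :
    HasDerivAt (fun s : ℝ => Complex.exp (Complex.I * ((c / s ^ α : ℝ) : ℂ)))
      (-Complex.I * α * c * ((z ^ (-α) : ℝ) : ℂ) / z *
        Complex.exp (Complex.I * ((c / z ^ α : ℝ) : ℂ))) z := by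
  have h := (((hasDerivAt_q α z hz).const_mul (c : ℂ)).const_mul Complex.I).cexp
  have hev : (fun s : ℝ => Complex.exp (Complex.I * ((c / s ^ α : ℝ) : ℂ))) =ᶠ[nhds z]
      fun s : ℝ => Complex.exp (Complex.I * ((c : ℂ) * ((s ^ (-α) : ℝ) : ℂ))) := by
    filter_upwards [lt_mem_nhds hz] with s hs
    rw [Real.rpow_neg hs.le]
    push_cast
    rw [div_eq_mul_inv]
  refine (h.congr_of_eventuallyEq hev).congr_deriv ?_
  rw [hev.eq_of_nhds]
  ring

theorem hasDerivAt_E1 (α c z : ℝ) (hz : 0 < z) :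
    HasDerivAt (fun z : ℝ => -Complex.I * α * c * ((z ^ (-α) : ℝ) : ℂ) / z *
        Complex.exp (Complex.I * ((c / z ^ α : ℝ) : ℂ)))
      ((Complex.I * α * (α + 1) * c * ((z ^ (-α) : ℝ) : ℂ)
        - α ^ 2 * c ^ 2 * ((z ^ (-α) : ℝ) : ℂ) ^ 2) / (z : ℂ) ^ 2 *
        Complex.exp (Complex.I * ((c / z ^ α : ℝ) : ℂ))) z := by
  have hzc : (z : ℂ) ≠ 0 := by exact_mod_cast hz.ne'
  have hid : HasDerivAt (fun s : ℝ => (s : ℂ)) 1 z := by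
    simpa using (hasDerivAt_id z).ofReal_comp
  have h := ((((hasDerivAt_q α z hz).const_mul (-Complex.I * α * c)).div hid hzc)).mul
    (hasDerivAt_E α c z hz)
  refine h.congr_deriv ?_
  simp only [Pi.div_apply]
  field_simp
  ring_nf
  simp only [Complex.I_sq]
  ring

theorem hasDerivAt_E2 (α c z : ℝ) (hz : 0 < z) :
    HasDerivAt (fun z : ℝ => -((α/2 : ℝ) : ℂ) *
        Complex.exp (Complex.I * ((c / z ^ α : ℝ) : ℂ)) / (z : ℂ))
      (((α/2 : ℂ) + Complex.I * α ^ 2 / 2 * c * ((z ^ (-α) : ℝ) : ℂ)) / (z : ℂ) ^ 2 *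
        Complex.exp (Complex.I * ((c / z ^ α : ℝ) : ℂ))) z := by
  have hzc : (z : ℂ) ≠ 0 := by exact_mod_cast hz.ne'
  have hid : HasDerivAt (fun s : ℝ => (s : ℂ)) 1 z := by
    simpa using (hasDerivAt_id z).ofReal_comp
  have h := ((hasDerivAt_E α c z hz).const_mul (-((α/2 : ℝ) : ℂ))).div hid hzc
  refine h.congr_deriv ?_
  push_cast
  field_simp
  ring

theorem W_main (m : ℕ) (hm : Even m) (α lam : ℝ) (v : (Fin m → ℝ) → ℂ) (hv : ContDiff ℝ 2 v)
    (heig : ∀ y, twistedLap m v y = (lam : ℂ) * v y) (t : ℝ) (y : Fin m → ℝ) (z : ℝ)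
    (hz : 0 < z) :
      Complex.I * deriv (fun s => Wfun m α lam v s (y, z)) t
          - magSq (aZ m α) (Wfun m α lam v t) (y, z) =
        (Complex.exp (Complex.I * ((lam * t / z ^ α : ℝ) : ℂ)) / ((z ^ 2 : ℝ) : ℂ)) *
          ((((α^2 * lam^2 * t^2 / z ^ (2*α) : ℝ) : ℂ)
              - Complex.I * ((α * (α + 1) * lam * t / z ^ α : ℝ) : ℂ))
              * v (fun i => y i / z ^ (α/2))
            - (Complex.I * ((α^2 * lam * t / z ^ α : ℝ) : ℂ)
                + ((α * (α + 2) / 4 : ℝ) : ℂ))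
              * Gv m v (fun i => y i / z ^ (α/2))
            - ((α^2 / 4 : ℝ) : ℂ) * Hv m v (fun i => y i / z ^ (α/2))) := by
  have hzc : (z : ℂ) ≠ 0 := by exact_mod_cast hz.ne'
  have hvd : Differentiable ℝ v := hv.differentiable (by norm_num)
  have hpd := differentiable_pd v hv
  have hG := differentiable_Gv v hv
  have hpos : ∀ᶠ x : (Fin m → ℝ) × ℝ in nhds (y, z), 0 < x.2 :=
    (continuous_snd.tendsto (y, z)).eventually (lt_mem_nhds hz)
  set E : ℝ → ℂ := fun s => Complex.exp (Complex.I * ((lam * t / s ^ α : ℝ) : ℂ)) with hE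
  -- first derivatives
  have hW := fun (y' : Fin m → ℝ) (z' : ℝ) (hz' : 0 < z') =>
    core α v hvd E _ y' z' hz' (hasDerivAt_E α (lam * t) z' hz')
  have hY1 : ∀ i, pdY (Wfun m α lam v t) i =ᶠ[nhds (y, z)] fun x =>
      (E x.2 * ((x.2 ^ (-(α/2)) : ℝ) : ℂ)) * pd v i (fun i => x.1 i / x.2 ^ (α/2)) := by
    intro i
    filter_upwards [hpos] with x hx
    exact (hW x.1 x.2 hx).2.1 i
  have hZ1 : pdZ (Wfun m α lam v t) =ᶠ[nhds (y, z)] fun x =>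
      (-Complex.I * α * (lam * t : ℝ) * ((x.2 ^ (-α) : ℝ) : ℂ) / x.2 *
        Complex.exp (Complex.I * (((lam * t) / x.2 ^ α : ℝ) : ℂ))) *
        v (fun i => x.1 i / x.2 ^ (α/2)) +
      (-((α/2 : ℝ) : ℂ) *
        Complex.exp (Complex.I * (((lam * t) / x.2 ^ α : ℝ) : ℂ)) / (x.2 : ℂ)) *
        Gv m v (fun i => x.1 i / x.2 ^ (α/2)) := by
    filter_upwards [hpos] with x hx
    exact (hW x.1 x.2 hx).2.2
  -- second derivatives
  have hr2 := (hasDerivAt_q (α/2) z hz)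
  have hY2 : ∀ i, pdY (pdY (Wfun m α lam v t) i) i (y, z) =
      (E z * ((z ^ (-(α/2)) : ℝ) : ℂ) * ((z ^ (-(α/2)) : ℝ) : ℂ)) *
        pd (pd v i) i (fun i => y i / z ^ (α/2)) := by
    intro i
    have h := (core α (pd v i) (hpd i) (fun s => E s * ((s ^ (-(α/2)) : ℝ) : ℂ)) _ y z hz
      ((hasDerivAt_E α (lam * t) z hz).mul hr2)).2.1 i
    rw [← h, pdY, (hY1 i).fderiv_eq]
    rfl
  have hA := core α v hvd _ _ y z hz (hasDerivAt_E1 α (lam * t) z hz)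
  have hB := core α (Gv m v) hG _ _ y z hz (hasDerivAt_E2 α (lam * t) z hz)
  have hZ2 := congrArg₂ (· + ·) hA.2.2 hB.2.2
  have hZ3 := congrArg (fun L => L ((0 : Fin m → ℝ), (1 : ℝ)))
    (hZ1.fderiv_eq (𝕜 := ℝ) |>.trans (fderiv_fun_add hA.1 hB.1))
  replace hZ2 : pdZ (pdZ (Wfun m α lam v t)) (y, z) = _ := hZ3.trans hZ2
  clear hZ3
  have hT : HasDerivAt (fun s => Wfun m α lam v s (y, z))
      (Complex.I * lam * ((z ^ (-α) : ℝ) : ℂ) * Wfun m α lam v t (y, z)) t := by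
    have hid : HasDerivAt (fun s : ℝ => ((lam * s / z ^ α : ℝ) : ℂ)) ((lam * 1 / z ^ α : ℝ) : ℂ) t :=
      (((hasDerivAt_id t).const_mul lam).div_const (z ^ α)).ofReal_comp
    have := ((hid.const_mul Complex.I).cexp).mul_const (omegaFn m α v (y, z))
    refine this.congr_deriv ?_
    rw [Real.rpow_neg hz.le, Wfun]
    push_cast
    ring
  have hWval : Wfun m α lam v t (y, z) = E z * v (fun i => y i / z ^ (α/2)) := rfl
  have hdot : dotGrad (aZ m α (y, z)) (Wfun m α lam v t) (y, z) =
      E z * ((z ^ (-α) : ℝ) : ℂ) * ∑ i, (((omegaMat m).mulVec (fun i => y i / z ^ (α/2)) i : ℝ) : ℂ) *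
        pd v i (fun i => y i / z ^ (α/2)) := by
    have hmv : (omegaMat m).mulVec (fun i => y i / z ^ (α/2)) =
        z ^ (-(α/2)) • (omegaMat m).mulVec y := by
      rw [← Matrix.mulVec_smul]
      congr 1
      ext i
      rw [Real.rpow_neg hz.le, Pi.smul_apply, smul_eq_mul, div_eq_inv_mul]
    simp only [dotGrad, aZ, (hY1 _).eq_of_nhds, hmv]
    rw [Finset.mul_sum]
    simp only [Complex.ofReal_zero, zero_mul, add_zero]
    refine Finset.sum_congr rfl fun i _ => ?_
    rw [Pi.smul_apply, smul_eq_mul]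
    push_cast
    ring
  have hq : z ^ (-(α/2)) * z ^ (-(α/2)) = z ^ (-α) := by
    rw [← Real.rpow_add hz]; congr 1; ring
  have hqC : ((z ^ (-(α/2)) : ℝ) : ℂ) * ((z ^ (-(α/2)) : ℝ) : ℂ) = ((z ^ (-α) : ℝ) : ℂ) := by
    exact_mod_cast hq
  have hnorm : normSqPair (aZ m α (y, z)) =
      z ^ (-α) * euclNorm (fun i => y i / z ^ (α/2)) ^ 2 := by
    simp only [normSqPair, euclNorm_sq, aZ, mul_pow, ← Finset.mul_sum, sum_omega_sq hm]
    simp only [div_pow, ← Finset.sum_div]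
    have : (z ^ (α/2)) ^ 2 = (z ^ (-α))⁻¹ := by
      rw [← hq, Real.rpow_neg hz.le]; field_simp
    rw [this]
    have : z ^ (-α) ≠ 0 := (Real.rpow_pos_of_pos hz _).ne'
    field_simp
    ring
  have hq2 : z ^ (2 * α) = (z ^ (-α) * z ^ (-α))⁻¹ := by
    rw [← Real.rpow_add hz, ← Real.rpow_neg hz.le]; congr 1; ring
  have hq1 : z ^ α = (z ^ (-α))⁻¹ := by
    rw [← Real.rpow_neg hz.le]; congr 1; ring
  have he := heig (fun i => y i / z ^ (α/2))
  rw [hT.deriv, magSq, lapX, divX_aZ m α y z hz, hZ2, hdot, hnorm, hWval, Gv_Gv v hpd]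
  simp only [hY2, ← Finset.mul_sum]
  rw [mul_assoc (E z), hqC]
  rw [twistedLap, lapV] at he
  change _ = E z / _ * _
  have hEz : Complex.exp (Complex.I * ((lam * t / z ^ α : ℝ) : ℂ)) = E z := rfl
  rw [hEz]
  generalize E z = e at *
  generalize (∑ i, pd (pd v i) i fun i => y i / z ^ (α/2)) = L at *
  generalize (∑ i, (((omegaMat m).mulVec (fun i => y i / z ^ (α/2)) i : ℝ) : ℂ) *
        pd v i (fun i => y i / z ^ (α/2))) = D at *
  generalize euclNorm (fun i => y i / z ^ (α/2)) = N at *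
  generalize Gv m v (fun i => y i / z ^ (α/2)) = G at *
  generalize Hv m v (fun i => y i / z ^ (α/2)) = H at *
  generalize v (fun i => y i / z ^ (α/2)) = V at *
  rw [hq2, hq1]
  generalize z ^ (-α) = q at *
  clear hZ2 hY2 hA hB hW hdot hT hWval hY1 hZ1
  push_cast at he ⊢
  simp only [div_inv_eq_mul]
  have hI := Complex.I_sq
  field_simp
  linear_combination (16 * e * q * z ^ 2) * he + (16 * e * lam * q * V * z ^ 2) * hI

/-- The identity `i ∂_t W - (∇ - i z^{-α} M(y,0)ᵗ)² W = F(t,y,z)`. -/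
theorem W_equation_odd (n : ℕ) (hn : 3 ≤ n) (hodd : Odd n)
    (α : ℝ) (hα1 : 1 < α) (hα2 : α < 2)
    (lam : ℝ) (v : (Fin (n-1) → ℝ) → ℂ) (hv : ContDiff ℝ (⊤ : ℕ∞) v)
    (heig : ∀ y, twistedLap (n-1) v y = (lam : ℂ) * v y) :
    ∀ (t : ℝ) (y : Fin (n-1) → ℝ) (z : ℝ), 0 < z →
      Complex.I * deriv (fun s => Wfun (n-1) α lam v s (y, z)) t
          - magSq (aZ (n-1) α) (Wfun (n-1) α lam v t) (y, z) =
        (Complex.exp (Complex.I * ((lam * t / z ^ α : ℝ) : ℂ)) / ((z ^ 2 : ℝ) : ℂ)) *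
          ((((α^2 * lam^2 * t^2 / z ^ (2*α) : ℝ) : ℂ)
              - Complex.I * ((α * (α + 1) * lam * t / z ^ α : ℝ) : ℂ))
              * v (fun i => y i / z ^ (α/2))
            - (Complex.I * ((α^2 * lam * t / z ^ α : ℝ) : ℂ)
                + ((α * (α + 2) / 4 : ℝ) : ℂ))
              * Gv (n-1) v (fun i => y i / z ^ (α/2))
            - ((α^2 / 4 : ℝ) : ℂ) * Hv (n-1) v (fun i => y i / z ^ (α/2))) := by
  intro t y z hz
  have hm : Even (n - 1) := by
    obtain ⟨k, hk⟩ := hodd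
    exact ⟨k, by omega⟩
  exact W_main (n-1) hm α lam v (hv.of_le (WithTop.coe_le_coe.2 (le_top : (2 : ℕ∞) ≤ ⊤))) heig t y z hz
end
end
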